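/- Let n ≥ 2, assume (H1) (so in particular (−1)^{n+1}B(0N)>0), and suppose the f_j are in normalized triangular form with α_{j,n+1−j}>0 (1≤j≤n). For 1≤ν≤n+1 let D_ν(x) denote the determinant of the n×n Jacobian matrix of the n functions (f_1,…,f_{ν−1},f_{ν+1},…,f_{n+1}) at x. Then for all x∈ℝⁿ: Σ_{ν=1}^{n+1} (−1)^{ν−1} f_ν(x) · D_ν(x) = (2^n (−1)^{n(n−1)/2+1} / √((−1)^{n+1} 2^n B(0N))) · ( − Σ_{ν=1}^{n+1} B(0⋆∂_νN | 0 ν ∂_νN) · f_ν(x) + B(0⋆N) ), where ∂_νN := N∖{ν}. -/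

import Mathlib

open MeasureTheory Metric Finset
open scoped BigOperators

namespace SchlafliVol

/-- Row/column labels for Cayley–Menger determinants: `zero` = 0, `star` = ⋆,
`idx j` = the hypersphere index `j ∈ N`. -/
inductive Lbl (m : ℕ) : Type where
  | zero : Lbl m
  | star : Lbl m
  | idx : Fin m → Lbl m

variable {m : ℕ}

/-- The entry of the Cayley–Menger matrix attached to a pair of labels,
for radii `rad` and mutual center distances `ρ`. -/
def ent (rad : Fin m → ℝ) (ρ : Fin m → Fin m → ℝ) : Lbl m → Lbl m → ℝ
  | Lbl.zero, Lbl.zero => 0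
  | Lbl.star, Lbl.star => 0
  | Lbl.zero, Lbl.star => 1
  | Lbl.star, Lbl.zero => 1
  | Lbl.zero, Lbl.idx _ => 1
  | Lbl.idx _, Lbl.zero => 1
  | Lbl.star, Lbl.idx k => rad k ^ 2
  | Lbl.idx j, Lbl.star => rad j ^ 2
  | Lbl.idx j, Lbl.idx k => ρ j k ^ 2

/-- `B(R|C)`: the Cayley–Menger determinant attached to two equal-length
sequences of labels. -/
noncomputable def Bdet (rad : Fin m → ℝ) (ρ : Fin m → Fin m → ℝ) {p : ℕ}
    (R C : Fin p → Lbl m) : ℝ :=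
  Matrix.det (Matrix.of fun i j => ent rad ρ (R i) (C j))

/-- The label sequence `(0, J)` (elements of `J` in increasing order). -/
noncomputable def seq0 (J : Finset (Fin m)) : Fin (J.card + 1) → Lbl m :=
  Fin.cons Lbl.zero fun i => Lbl.idx (J.orderEmbOfFin rfl i)

/-- The label sequence `(0, ⋆, J)`. -/
noncomputable def seq0s (J : Finset (Fin m)) : Fin (J.card + 1 + 1) → Lbl m :=
  Fin.cons Lbl.zero <| Fin.cons Lbl.star fun i => Lbl.idx (J.orderEmbOfFin rfl i)

/-- The label sequence `(0, ν, J)`. -/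
noncomputable def seq0i (ν : Fin m) (J : Finset (Fin m)) : Fin (J.card + 1 + 1) → Lbl m :=
  Fin.cons Lbl.zero <| Fin.cons (Lbl.idx ν) fun i => Lbl.idx (J.orderEmbOfFin rfl i)

/-- `B(0J)`. -/
noncomputable def B0 (rad : Fin m → ℝ) (ρ : Fin m → Fin m → ℝ) (J : Finset (Fin m)) : ℝ :=
  Bdet rad ρ (seq0 J) (seq0 J)

/-- `B(0⋆J)`. -/
noncomputable def B0s (rad : Fin m → ℝ) (ρ : Fin m → Fin m → ℝ) (J : Finset (Fin m)) : ℝ :=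
  Bdet rad ρ (seq0s J) (seq0s J)

/-- `B(0 ⋆ K | 0 ν K)`. -/
noncomputable def Bmix (rad : Fin m → ℝ) (ρ : Fin m → Fin m → ℝ) (ν : Fin m)
    (K : Finset (Fin m)) : ℝ :=
  Bdet rad ρ (seq0s K) (seq0i ν K)

/-- `B(0 L)` for an ordered list `L` of indices. -/
noncomputable def B0L (rad : Fin m → ℝ) (ρ : Fin m → Fin m → ℝ) (L : List (Fin m)) : ℝ :=
  Bdet rad ρ (Fin.cons Lbl.zero fun i => Lbl.idx (L.get i))
    (Fin.cons Lbl.zero fun i => Lbl.idx (L.get i))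

/-- `B(0 ⋆ L | 0 ν L)` for an ordered list `L` of indices. -/
noncomputable def BmixL (rad : Fin m → ℝ) (ρ : Fin m → Fin m → ℝ) (ν : Fin m)
    (L : List (Fin m)) : ℝ :=
  Bdet rad ρ (Fin.cons Lbl.zero <| Fin.cons Lbl.star fun i => Lbl.idx (L.get i))
    (Fin.cons Lbl.zero <| Fin.cons (Lbl.idx ν) fun i => Lbl.idx (L.get i))

/-- Given an ordered sequence `μ₁ :: μ₂ :: …` (first argument) and the current
tail `(μ_{ν-1}, …, μ₁, j, k)` (second argument), the product
`∏_ν B(0 ⋆ μ_{ν-1}⋯μ₁ j k | 0 μ_ν μ_{ν-1}⋯μ₁ j k) / B(0 μ_ν μ_{ν-1}⋯μ₁ j k)`. -/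
noncomputable def thetaProd (rad : Fin m → ℝ) (ρ : Fin m → Fin m → ℝ) :
    List (Fin m) → List (Fin m) → ℝ
  | [], _ => 1
  | μ :: rest, tail =>
      (BmixL rad ρ μ tail / B0L rad ρ (μ :: tail)) * thetaProd rad ρ rest (μ :: tail)

/-- The 1-form coefficient `Θ_J(t)` along a family `t ↦ (rad t, ρ t)`:
`Θ_j = -(1/2) d/dt log r_j²` and, for `|J| = p ≥ 2`,
`Θ_J = (-1)^p Σ_{{j,k}⊆J} (1/2)(d/dt log B(0jk)) Σ_{(μ₁,…,μ_{p-2})} ∏ …`. -/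
noncomputable def Theta (rad : ℝ → Fin m → ℝ) (ρ : ℝ → Fin m → Fin m → ℝ)
    (J : Finset (Fin m)) (t : ℝ) : ℝ :=
  if J.card = 1 then
    ∑ j ∈ J, -(1 / 2 : ℝ) * deriv (fun s => Real.log (rad s j ^ 2)) t
  else
    (-1 : ℝ) ^ J.card *
      ∑ j ∈ J, ∑ k ∈ J,
        (if j < k then
          (1 / 2 : ℝ) * deriv (fun s => Real.log (B0 (rad s) (ρ s) {j, k})) t *
            ((((J \ {j, k}).sort (· ≤ ·)).permutations.map
              fun L => thetaProd (rad t) (ρ t) L [j, k]).sum)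
        else 0)

/-- Hypothesis (H1). -/
def H1 (rad : Fin m → ℝ) (ρ : Fin m → Fin m → ℝ) : Prop :=
  ∀ J : Finset (Fin m), J.Nonempty →
    0 < (-1 : ℝ) ^ J.card * B0 rad ρ J ∧ 0 < (-1 : ℝ) ^ (J.card + 1) * B0s rad ρ J

/-- Hypothesis (H1′). -/
def H1' {n : ℕ} (rad : Fin (n + 1) → ℝ) (ρ : Fin (n + 1) → Fin (n + 1) → ℝ) : Prop :=
  (∀ J : Finset (Fin (n + 1)), J.Nonempty → J.card ≤ n →
    0 < (-1 : ℝ) ^ J.card * B0 rad ρ J ∧ 0 < (-1 : ℝ) ^ (J.card + 1) * B0s rad ρ J) ∧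
  0 < (-1 : ℝ) ^ (n + 1) * B0 rad ρ (Finset.univ : Finset (Fin (n + 1))) ∧
  (-1 : ℝ) ^ n * B0s rad ρ (Finset.univ : Finset (Fin (n + 1))) < 0

variable {n : ℕ}

/-- The quadratic polynomial `f_j(x) = |x|² + 2⟨a_j, x⟩ + α_{j0}`. -/
noncomputable def fQ (a : Fin (n + 1) → EuclideanSpace ℝ (Fin n)) (α0 : Fin (n + 1) → ℝ)
    (j : Fin (n + 1)) (x : EuclideanSpace ℝ (Fin n)) : ℝ :=
  ‖x‖ ^ 2 + 2 * (inner ℝ (a j) x : ℝ) + α0 j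

/-- The radius `r_j = √(|a_j|² - α_{j0})` of the hypersphere `S_j`. -/
noncomputable def radius (a : Fin (n + 1) → EuclideanSpace ℝ (Fin n)) (α0 : Fin (n + 1) → ℝ)
    (j : Fin (n + 1)) : ℝ :=
  Real.sqrt (‖a j‖ ^ 2 - α0 j)

/-- The mutual distance `ρ_{jk} = |O_j - O_k|` of the centers `O_j = -a_j`. -/
noncomputable def cdist (a : Fin (n + 1) → EuclideanSpace ℝ (Fin n)) (j k : Fin (n + 1)) : ℝ :=
  dist (a j) (a k)

/-- The intersection `S_J = ⋂_{j ∈ J} S_j` of the hyperspheres `S_j = {f_j = 0}`. -/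
def sphI (a : Fin (n + 1) → EuclideanSpace ℝ (Fin n)) (α0 : Fin (n + 1) → ℝ)
    (J : Finset (Fin (n + 1))) : Set (EuclideanSpace ℝ (Fin n)) :=
  {x | ∀ j ∈ J, fQ a α0 j x = 0}

/-- The pseudo-simplex `D = D_N^- = ⋂_j {f_j ≤ 0}`. -/
def Dm (a : Fin (n + 1) → EuclideanSpace ℝ (Fin n)) (α0 : Fin (n + 1) → ℝ) :
    Set (EuclideanSpace ℝ (Fin n)) :=
  {x | ∀ j, fQ a α0 j x ≤ 0}

/-- The chamber `D_N^+ = ⋂_j {f_j ≥ 0}`. -/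
def Dp (a : Fin (n + 1) → EuclideanSpace ℝ (Fin n)) (α0 : Fin (n + 1) → ℝ) :
    Set (EuclideanSpace ℝ (Fin n)) :=
  {x | ∀ j, 0 ≤ fQ a α0 j x}

/-- The chamber `D_K^- ∩ D_{K^c}^+`. -/
def Dmix (a : Fin (n + 1) → EuclideanSpace ℝ (Fin n)) (α0 : Fin (n + 1) → ℝ)
    (K : Finset (Fin (n + 1))) : Set (EuclideanSpace ℝ (Fin n)) :=
  {x | ∀ j, if j ∈ K then fQ a α0 j x ≤ 0 else 0 ≤ fQ a α0 j x}

/-- Normalized triangular form: `α_{jν} = 0` for `ν > n + 1 - j`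
(1-based paper indices; here `j`, `ν` are 0-based). -/
def Triangular (a : Fin (n + 1) → EuclideanSpace ℝ (Fin n)) : Prop :=
  ∀ j : Fin (n + 1), ∀ ν : Fin n, n - (j : ℕ) ≤ (ν : ℕ) → a j ν = 0

/-- Positivity `α_{j, n+1-j} > 0` of the diagonal coefficients (`1 ≤ j ≤ n`). -/
def DiagPos (a : Fin (n + 1) → EuclideanSpace ℝ (Fin n)) : Prop :=
  ∀ j : Fin (n + 1), ∀ ν : Fin n, (j : ℕ) < n → (ν : ℕ) = n - (j : ℕ) - 1 → 0 < a j ν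

/-- Hypothesis (H2): the `(n+1-j)`-th coordinate of the vertex `P_j` is negative. -/
def H2 (P : Fin (n + 1) → EuclideanSpace ℝ (Fin n)) : Prop :=
  ∀ j : Fin (n + 1), ∀ ν : Fin n, (j : ℕ) < n → (ν : ℕ) = n - (j : ℕ) - 1 → P j ν < 0

/-- The rational function `W₀(J)`. -/
noncomputable def W0 (a : Fin (n + 1) → EuclideanSpace ℝ (Fin n)) (α0 : Fin (n + 1) → ℝ)
    (J : Finset (Fin (n + 1))) (x : EuclideanSpace ℝ (Fin n)) : ℝ :=
  - ∑ ν ∈ J, Bmix (radius a α0) (cdist a) ν (J.erase ν) * ∏ μ ∈ J.erase ν, (fQ a α0 μ x)⁻¹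
    + B0s (radius a α0) (cdist a) J * ∏ μ ∈ J, (fQ a α0 μ x)⁻¹

/-- The vector `(g i, b i)`. -/
def augRow (g : Fin (n + 1) → ℝ) (b : Fin (n + 1) → Fin n → ℝ) (i : Fin (n + 1)) :
    Fin (n + 1) → ℝ :=
  Fin.cons (g i) (b i)

/-- The square matrix with rows `(g i, b i)`. -/
def augMatrix (g : Fin (n + 1) → ℝ) (b : Fin (n + 1) → Fin n → ℝ) :
    Matrix (Fin (n + 1)) (Fin (n + 1)) ℝ :=
  Matrix.of (augRow g b)

theorem det_cons_one_zero {k : ℕ} (q : Fin k → ℝ) (v : Fin k → Fin k → ℝ) :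
    Matrix.det (Matrix.of (Fin.cons (Fin.cons 1 0) fun j => Fin.cons (q j) (v j) :
      Fin (k + 1) → Fin (k + 1) → ℝ)) = Matrix.det (Matrix.of v) := by
  rw [Matrix.det_succ_row_zero, Fin.sum_univ_succ]
  simp only [Matrix.of_apply, Fin.cons_zero, Fin.cons_succ, Pi.zero_apply, mul_zero, zero_mul,
    Finset.sum_const_zero, add_zero, Fin.val_zero, pow_zero, one_mul]
  rfl

theorem det_cons_zero_one {k : ℕ} (p q : Fin (k + 1) → ℝ) (v : Fin (k + 1) → Fin k → ℝ) :
    Matrix.det (Matrix.of (Fin.cons (Fin.cons 0 (Fin.cons 1 0))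
      fun j => Fin.cons (p j) (Fin.cons (q j) (v j)) : Fin (k + 2) → Fin (k + 2) → ℝ)) =
      -Matrix.det (augMatrix p v) := by
  rw [Matrix.det_succ_row_zero, Fin.sum_univ_succ, Fin.sum_univ_succ]
  simp only [Matrix.of_apply, Fin.cons_zero, Fin.cons_succ, Pi.zero_apply, mul_zero, zero_mul,
    Finset.sum_const_zero, add_zero, zero_add, Fin.succ_zero_eq_one, Fin.val_one, pow_one,
    neg_mul, one_mul]
  change -((1 : ℝ) * _) = _
  rw [one_mul]
  refine congrArg (fun M : Matrix (Fin (k + 1)) (Fin (k + 1)) ℝ => -M.det) ?_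
  ext i j
  refine Fin.cases ?_ (fun l => ?_) j
  · simp [augMatrix, augRow]
  · have h : (1 : Fin (k + 2)).succAbove l.succ = l.succ.succ :=
      Fin.succ_succAbove_succ 0 l
    simp [augMatrix, augRow, h]

theorem det_augMatrix_smul (c : ℝ) (g : Fin (n + 1) → ℝ) (b : Fin (n + 1) → Fin n → ℝ) :
    Matrix.det (augMatrix g fun i => c • b i) = c ^ n * Matrix.det (augMatrix g b) := by
  have h := Matrix.det_mul_row (Fin.cons 1 fun _ => c : Fin (n + 1) → ℝ) (augMatrix g b)
  rw [Fin.prod_univ_succ] at h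
  simp only [Fin.cons_zero, Fin.cons_succ, Finset.prod_const, Finset.card_univ, Fintype.card_fin,
    one_mul] at h
  rw [← h]
  congr 1
  ext i j
  refine Fin.cases ?_ (fun l => ?_) j <;> simp [augMatrix, augRow]

theorem det_augMatrix_add_const (b : Fin (n + 1) → Fin n → ℝ) (x : Fin n → ℝ) :
    Matrix.det (augMatrix 1 fun i => b i + x) = Matrix.det (augMatrix 1 b) := by
  rw [← Matrix.det_transpose, ← Matrix.det_transpose (augMatrix 1 b)]
  refine Matrix.det_eq_of_forall_row_eq_smul_add_const (Fin.cons 0 x : Fin (n + 1) → ℝ) 0 rfl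
    fun i j => ?_
  refine Fin.cases ?_ (fun l => ?_) i <;> simp [augMatrix, augRow]

theorem det_antitriangular_pos (k : ℕ) (M : Matrix (Fin k) (Fin k) ℝ)
    (hzero : ∀ i j : Fin k, k ≤ (i : ℕ) + j → M i j = 0)
    (hpos : ∀ i j : Fin k, (i : ℕ) + j + 1 = k → 0 < M i j) :
    0 < (-1 : ℝ) ^ (∑ i ∈ Finset.range k, i) * M.det := by
  induction k with
  | zero => simp
  | succ k ih =>
    have hminor := ih (M.submatrix (Fin.last k).succAbove (Fin.succAbove 0))
      (fun i j hij => by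
        apply hzero
        simp only [Fin.succAbove_last, Fin.succAbove_zero, Fin.val_castSucc, Fin.val_succ]
        omega)
      (fun i j hij => by
        apply hpos
        simp only [Fin.succAbove_last, Fin.succAbove_zero, Fin.val_castSucc, Fin.val_succ]
        omega)
    have hcorner : 0 < M (Fin.last k) 0 := hpos _ _ (by simp)
    have hrest : ∀ j : Fin k, M (Fin.last k) j.succ = 0 := fun j =>
      hzero _ _ (by simp only [Fin.val_last, Fin.val_succ]; omega)
    rw [Matrix.det_succ_row M (Fin.last k), Fin.sum_univ_succ, Finset.sum_range_succ]
    simp only [hrest, mul_zero, zero_mul, Finset.sum_const_zero, add_zero, Fin.val_last,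
      Fin.val_zero, pow_add]
    have hsq : ((-1 : ℝ) ^ k) * (-1) ^ k = 1 := by rw [← mul_pow]; simp
    calc (0 : ℝ) < M (Fin.last k) 0 * _ := mul_pos hcorner hminor
      _ = ((-1 : ℝ) ^ k * (-1) ^ k) * (M (Fin.last k) 0 * _) := by rw [hsq, one_mul]
      _ = _ := by ring

/-- Factorization of the Cayley–Menger determinant of `n + 1` points of `ℝⁿ`. -/
theorem Bdet_zero_idx (rad : Fin (n + 1) → ℝ) (ρ : Fin (n + 1) → Fin (n + 1) → ℝ)
    (b : Fin (n + 1) → Fin n → ℝ)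
    (hρ : ∀ j k, ρ j k ^ 2 = b j ⬝ᵥ b j + b k ⬝ᵥ b k - 2 * b j ⬝ᵥ b k) :
    Bdet rad ρ (Fin.cons Lbl.zero Lbl.idx : Fin (n + 2) → Lbl (n + 1))
      (Fin.cons Lbl.zero Lbl.idx : Fin (n + 2) → Lbl (n + 1)) =
      -((-2) ^ n * Matrix.det (augMatrix 1 b) ^ 2) := by
  have hfac : (Matrix.of fun i j => ent rad ρ
      ((Fin.cons Lbl.zero Lbl.idx : Fin (n + 2) → Lbl (n + 1)) i)
      ((Fin.cons Lbl.zero Lbl.idx : Fin (n + 2) → Lbl (n + 1)) j)) =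
      (Matrix.of (Fin.cons (Fin.cons 1 0) fun j => Fin.cons (b j ⬝ᵥ b j) (augRow 1 b j) :
        Fin (n + 2) → Fin (n + 2) → ℝ)) *
      (Matrix.of (Fin.cons (Fin.cons 0 (Fin.cons 1 0))
        fun k => Fin.cons ((1 : Fin (n + 1) → ℝ) k)
          (Fin.cons (b k ⬝ᵥ b k) ((-2 : ℝ) • b k)) :
        Fin (n + 2) → Fin (n + 2) → ℝ)).transpose := by
    ext i j
    rw [Matrix.mul_apply, Fin.sum_univ_succ, Fin.sum_univ_succ]
    refine Fin.cases ?_ (fun i => ?_) i <;> refine Fin.cases ?_ (fun j => ?_) j <;>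
      simp [augRow, ent, hρ, dotProduct, Finset.mul_sum]
    rw [add_sub_assoc, sub_eq_add_neg, add_right_inj, add_right_inj, neg_inj]
    exact Finset.sum_congr rfl fun _ _ => by ring
  rw [Bdet, hfac, Matrix.det_mul, Matrix.det_transpose, det_cons_one_zero, det_cons_zero_one,
    det_augMatrix_smul]
  change Matrix.det (augMatrix 1 b) * _ = _
  ring

/-- The label sequence `(0, ⋆, 1, …, m)`. -/
def fullSeq (m : ℕ) : Fin (m + 2) → Lbl m :=
  Fin.cons Lbl.zero (Fin.cons Lbl.star Lbl.idx)

/-- The Cayley–Menger matrix on all labels. -/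
def fullMatrix (rad : Fin m → ℝ) (ρ : Fin m → Fin m → ℝ) : Matrix (Fin (m + 2)) (Fin (m + 2)) ℝ :=
  Matrix.of fun i j => ent rad ρ (fullSeq m i) (fullSeq m j)

theorem det_fullMatrix_updateCol (rad : Fin (n + 1) → ℝ) (ρ : Fin (n + 1) → Fin (n + 1) → ℝ)
    (b : Fin (n + 1) → Fin n → ℝ) (f : Fin (n + 1) → ℝ)
    (hρ : ∀ j k, ρ j k ^ 2 = b j ⬝ᵥ b j + b k ⬝ᵥ b k - 2 * b j ⬝ᵥ b k)
    (hf : ∀ j, rad j ^ 2 + f j = b j ⬝ᵥ b j) :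
    Matrix.det ((fullMatrix rad ρ).updateCol 1
      (Fin.cons 1 (Fin.cons 0 fun j => b j ⬝ᵥ b j) : Fin (n + 3) → ℝ)) =
      -((-2) ^ n * Matrix.det (augMatrix 1 b) * Matrix.det (augMatrix f b)) := by
  have hfac : (fullMatrix rad ρ).updateCol 1
      (Fin.cons 1 (Fin.cons 0 fun j => b j ⬝ᵥ b j) : Fin (n + 3) → ℝ) =
      (Matrix.of (Fin.cons (Fin.cons 1 0) fun i => Fin.cons
          ((Fin.cons 0 fun j => b j ⬝ᵥ b j : Fin (n + 2) → ℝ) i)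
          ((Fin.cons (Fin.cons 1 0) fun j => Fin.cons 1 (augRow 1 b j) :
            Fin (n + 2) → Fin (n + 2) → ℝ) i) :
        Fin (n + 3) → Fin (n + 3) → ℝ)) *
      (Matrix.of (Fin.cons (Fin.cons 0 (Fin.cons 1 0)) fun i => Fin.cons
          ((1 : Fin (n + 2) → ℝ) i) (Fin.cons
            ((Fin.cons 0 fun k => rad k ^ 2 : Fin (n + 2) → ℝ) i)
            ((Fin.cons 0 (augRow f fun k => (-2 : ℝ) • b k) :
              Fin (n + 2) → Fin (n + 1) → ℝ) i)) :
        Fin (n + 3) → Fin (n + 3) → ℝ)).transpose := by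
    have hne : (0 : Fin (n + 3)) ≠ Fin.succ 0 := (Fin.succ_ne_zero 0).symm
    ext i j
    rw [Matrix.mul_apply, Fin.sum_univ_succ, Fin.sum_univ_succ, Fin.sum_univ_succ,
      Matrix.updateCol_apply, ← Fin.succ_zero_eq_one]
    refine Fin.cases ?_ (fun i => Fin.cases ?_ (fun i => ?_) i) i <;>
      refine Fin.cases ?_ (fun j => Fin.cases ?_ (fun j => ?_) j) j <;>
      simp [augRow, ent, fullMatrix, fullSeq, hρ, hne, -Fin.succ_zero_eq_one,
        -Fin.succ_zero_eq_one', -Fin.succ_one_eq_two, -Fin.succ_one_eq_two']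
    have hdot : ∑ l, b i l * (2 * b j l) = 2 * b i ⬝ᵥ b j := by
      rw [dotProduct, Finset.mul_sum]
      exact Finset.sum_congr rfl fun _ _ => by ring
    linarith [hf j]
  have hT : (augMatrix (1 : Fin (n + 2) → ℝ)
      (Fin.cons 0 (augRow f fun k => (-2 : ℝ) • b k))) =
      Matrix.of (Fin.cons (Fin.cons 1 0) fun k =>
        Fin.cons 1 (augRow f (fun k => (-2 : ℝ) • b k) k) :
        Fin (n + 2) → Fin (n + 2) → ℝ) := by
    ext i j
    refine Fin.cases ?_ (fun i => ?_) i <;> rfl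
  rw [hfac, Matrix.det_mul, Matrix.det_transpose, det_cons_one_zero, det_cons_one_zero,
    det_cons_zero_one, hT, det_cons_one_zero]
  change Matrix.det (augMatrix 1 b) * -Matrix.det (augMatrix f fun k => (-2 : ℝ) • b k) = _
  rw [det_augMatrix_smul]
  ring

theorem orderEmbOfFin_univ_eq_id (h : (Finset.univ : Finset (Fin m)).card = m) :
    ((Finset.univ : Finset (Fin m)).orderEmbOfFin h : Fin m → Fin m) = id :=
  (Finset.orderEmbOfFin_unique h (fun _ => Finset.mem_univ _) strictMono_id).symm

theorem orderEmbOfFin_erase_eq_succAbove (ν : Fin (m + 1))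
    (h : ((Finset.univ : Finset (Fin (m + 1))).erase ν).card = m) :
    ((Finset.univ.erase ν).orderEmbOfFin h : Fin m → Fin (m + 1)) = ν.succAbove :=
  (Finset.orderEmbOfFin_unique h
    (fun i => Finset.mem_erase.2 ⟨Fin.succAbove_ne ν i, Finset.mem_univ _⟩)
    (Fin.strictMono_succAbove ν)).symm

theorem B0_eq_Bdet (rad : Fin m → ℝ) (ρ : Fin m → Fin m → ℝ) (J : Finset (Fin m)) {k : ℕ}
    (h : J.card = k) :
    B0 rad ρ J = Bdet rad ρ
      (Fin.cons Lbl.zero fun i => Lbl.idx (J.orderEmbOfFin h i) : Fin (k + 1) → Lbl m)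
      (Fin.cons Lbl.zero fun i => Lbl.idx (J.orderEmbOfFin h i)) := by
  subst h
  rfl

theorem B0s_eq_Bdet (rad : Fin m → ℝ) (ρ : Fin m → Fin m → ℝ) (J : Finset (Fin m)) {k : ℕ}
    (h : J.card = k) :
    B0s rad ρ J = Bdet rad ρ
      (Fin.cons Lbl.zero (Fin.cons Lbl.star fun i => Lbl.idx (J.orderEmbOfFin h i)) :
        Fin (k + 2) → Lbl m)
      (Fin.cons Lbl.zero (Fin.cons Lbl.star fun i => Lbl.idx (J.orderEmbOfFin h i))) := by
  subst h
  rfl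

theorem Bmix_eq_Bdet (rad : Fin m → ℝ) (ρ : Fin m → Fin m → ℝ) (ν : Fin m) (J : Finset (Fin m))
    {k : ℕ} (h : J.card = k) :
    Bmix rad ρ ν J = Bdet rad ρ
      (Fin.cons Lbl.zero (Fin.cons Lbl.star fun i => Lbl.idx (J.orderEmbOfFin h i)) :
        Fin (k + 2) → Lbl m)
      (Fin.cons Lbl.zero (Fin.cons (Lbl.idx ν) fun i => Lbl.idx (J.orderEmbOfFin h i))) := by
  subst h
  rfl

theorem B0_univ (rad : Fin m → ℝ) (ρ : Fin m → Fin m → ℝ) :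
    B0 rad ρ Finset.univ = Bdet rad ρ
      (Fin.cons Lbl.zero Lbl.idx : Fin (m + 1) → Lbl m) (Fin.cons Lbl.zero Lbl.idx) := by
  rw [B0_eq_Bdet rad ρ _ (Finset.card_fin m), orderEmbOfFin_univ_eq_id]
  rfl

theorem B0s_univ (rad : Fin m → ℝ) (ρ : Fin m → Fin m → ℝ) :
    B0s rad ρ Finset.univ = (fullMatrix rad ρ).det := by
  rw [B0s_eq_Bdet rad ρ _ (Finset.card_fin m), orderEmbOfFin_univ_eq_id]
  rfl

theorem adjugate_fullMatrix (rad : Fin (m + 1) → ℝ) (ρ : Fin (m + 1) → Fin (m + 1) → ℝ)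
    (ν : Fin (m + 1)) :
    (fullMatrix rad ρ).adjugate 1 ν.succ.succ = -Bmix rad ρ ν (Finset.univ.erase ν) := by
  have hrow : ∀ i, fullSeq (m + 1) (ν.succ.succ.succAbove i) =
      (Fin.cons Lbl.zero (Fin.cons Lbl.star fun i => Lbl.idx (ν.succAbove i)) :
        Fin (m + 2) → Lbl (m + 1)) i := by
    refine Fin.cases ?_ fun i => Fin.cases ?_ (fun i => ?_) i
    · rfl
    · rfl
    · rw [Fin.succ_succAbove_succ, Fin.succ_succAbove_succ]
      rfl
  have hcol : ∀ j, (Fin.cons Lbl.zero (Fin.cons (Lbl.idx ν) fun i => Lbl.idx (ν.succAbove i)) :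
        Fin (m + 2) → Lbl (m + 1)) j =
      fullSeq (m + 1) ((1 : Fin (m + 3)).succAbove
        (Equiv.Perm.decomposeFin.symm (0, ν.cycleRange.symm) j)) := by
    have hone (l : Fin (m + 1)) : (1 : Fin (m + 3)).succAbove l.succ = l.succ.succ :=
      Fin.succ_succAbove_succ 0 l
    refine Fin.cases ?_ fun j => Fin.cases ?_ (fun j => ?_) j
    · rw [Equiv.Perm.decomposeFin_symm_apply_zero]
      rfl
    · rw [Equiv.Perm.decomposeFin_symm_apply_succ, Equiv.swap_self, Equiv.refl_apply, hone,
        Fin.cycleRange_symm_zero]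
      rfl
    · rw [Equiv.Perm.decomposeFin_symm_apply_succ, Equiv.swap_self, Equiv.refl_apply, hone,
        Fin.cycleRange_symm_succ]
      rfl
  have hcard : ((Finset.univ : Finset (Fin (m + 1))).erase ν).card = m := by simp
  have hperm := Matrix.det_permute' (Equiv.Perm.decomposeFin.symm (0, ν.cycleRange.symm))
    ((fullMatrix rad ρ).submatrix ν.succ.succ.succAbove (1 : Fin (m + 3)).succAbove)
  have hmix : Bmix rad ρ ν (Finset.univ.erase ν) = (((fullMatrix rad ρ).submatrix
      ν.succ.succ.succAbove (1 : Fin (m + 3)).succAbove).submatrix id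
        (Equiv.Perm.decomposeFin.symm (0, ν.cycleRange.symm))).det := by
    rw [Bmix_eq_Bdet rad ρ ν _ hcard, orderEmbOfFin_erase_eq_succAbove, Bdet]
    congr 1
    ext i j
    simp only [Matrix.of_apply, Matrix.submatrix_apply, fullMatrix, id, hrow, hcol]
  rw [hmix, hperm, Matrix.adjugate_fin_succ_eq_det_submatrix, Equiv.Perm.decomposeFin.symm_sign,
    Equiv.Perm.sign_symm, Fin.sign_cycleRange]
  simp [pow_succ]

/-- The bracket on the right-hand side as a single determinant, with the `⋆` column modified. -/
theorem neg_sum_Bmix_add_B0s (rad : Fin (m + 1) → ℝ) (ρ : Fin (m + 1) → Fin (m + 1) → ℝ)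
    (f : Fin (m + 1) → ℝ) :
    -(∑ ν, Bmix rad ρ ν (Finset.univ.erase ν) * f ν) + B0s rad ρ Finset.univ =
      Matrix.det ((fullMatrix rad ρ).updateCol 1
        (Fin.cons 1 (Fin.cons 0 fun j => rad j ^ 2 + f j) : Fin (m + 3) → ℝ)) := by
  have hsplit : (Fin.cons 1 (Fin.cons 0 fun j => rad j ^ 2 + f j) : Fin (m + 3) → ℝ) =
      (Fin.cons 0 (Fin.cons 0 f) : Fin (m + 3) → ℝ) + fun i => fullMatrix rad ρ i 1 := by
    ext i
    refine Fin.cases ?_ (fun i => Fin.cases ?_ (fun i => ?_) i) i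
    · exact (zero_add (1 : ℝ)).symm
    · exact (zero_add (0 : ℝ)).symm
    · exact add_comm _ _
  rw [hsplit, Matrix.det_updateCol_add, Matrix.updateCol_eq_self, B0s_univ, ← Matrix.cramer_apply,
    Matrix.cramer_eq_adjugate_mulVec, Matrix.mulVec, dotProduct,
    Fin.sum_univ_succ (n := m + 2), Fin.sum_univ_succ (n := m + 1)]
  simp only [Fin.cons_zero, Fin.cons_succ, mul_zero, zero_add, adjugate_fullMatrix, neg_mul,
    Finset.sum_neg_distrib]

theorem det_augMatrix_triangular_pos (a : Fin (n + 1) → EuclideanSpace ℝ (Fin n))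
    (htri : Triangular a) (hdiag : DiagPos a) :
    0 < (-1 : ℝ) ^ (∑ i ∈ Finset.range (n + 1), i) *
      Matrix.det (augMatrix 1 fun j => (a j : Fin n → ℝ)) := by
  refine det_antitriangular_pos _ _ (fun i j => ?_) (fun i j => ?_)
  · refine Fin.cases (fun h => ?_) (fun l h => ?_) j
    · exact absurd i.isLt (by simpa using h)
    · exact htri i l (by rw [Fin.val_succ] at h; omega)
  · refine Fin.cases (fun h => ?_) (fun l h => ?_) j
    · exact one_pos
    · rw [Fin.val_succ] at h
      exact hdiag i l (by omega) (by omega)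

theorem fderiv_fQ_single (a : Fin (n + 1) → EuclideanSpace ℝ (Fin n)) (α0 : Fin (n + 1) → ℝ)
    (j : Fin (n + 1)) (x : EuclideanSpace ℝ (Fin n)) (μ : Fin n) :
    fderiv ℝ (fQ a α0 j) x (EuclideanSpace.single μ (1 : ℝ)) = 2 * (a j μ + x μ) := by
  have h : HasFDerivAt (fQ a α0 j) (2 • innerSL ℝ x + (2 : ℝ) • innerSL ℝ (a j)) x :=
    ((hasStrictFDerivAt_norm_sq x).hasFDerivAt.add
      ((innerSL ℝ (a j)).hasFDerivAt.const_mul (2 : ℝ))).add_const (α0 j)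
  rw [h.fderiv]
  simp [EuclideanSpace.inner_single_right]
  ring

theorem sum_fQ_mul_jacobian (a : Fin (n + 1) → EuclideanSpace ℝ (Fin n)) (α0 : Fin (n + 1) → ℝ)
    (x : EuclideanSpace ℝ (Fin n)) :
    ∑ ν : Fin (n + 1), (-1 : ℝ) ^ (ν : ℕ) * fQ a α0 ν x *
        Matrix.det (Matrix.of fun (j : Fin n) (μ : Fin n) =>
          fderiv ℝ (fQ a α0 (ν.succAbove j)) x (EuclideanSpace.single μ (1 : ℝ))) =
      2 ^ n * Matrix.det (augMatrix (fun j => fQ a α0 j x)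
        fun j => (a j : Fin n → ℝ) + (x : Fin n → ℝ)) := by
  rw [← det_augMatrix_smul, Matrix.det_succ_column_zero]
  refine Finset.sum_congr rfl fun ν _ => ?_
  congr 2
  ext j μ
  rw [Matrix.of_apply, fderiv_fQ_single]
  simp [augMatrix, augRow, mul_add]

/-- **Lemma 4**: `Σ_ν (-1)^{ν-1} f_ν · D_ν = (2^n (-1)^{n(n-1)/2+1}/√((-1)^{n+1} 2^n B(0N)))
· (-Σ_ν B(0⋆∂_νN|0ν∂_νN) f_ν + B(0⋆N))`, where `D_ν` is the Jacobian determinant of the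
`n` functions obtained from `(f_1, …, f_{n+1})` by deleting `f_ν`. -/
theorem jacobian_sum_identity
    (n : ℕ) (hn : 2 ≤ n)
    (a : Fin (n + 1) → EuclideanSpace ℝ (Fin n)) (α0 : Fin (n + 1) → ℝ)
    (hrad : ∀ j, 0 < ‖a j‖ ^ 2 - α0 j)
    (hH1 : H1 (radius a α0) (cdist a))
    (htri : Triangular a) (hdiag : DiagPos a)
    (x : EuclideanSpace ℝ (Fin n)) :
    ∑ ν : Fin (n + 1), (-1 : ℝ) ^ (ν : ℕ) * fQ a α0 ν x *
        Matrix.det (Matrix.of fun (j : Fin n) (μ : Fin n) =>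
          fderiv ℝ (fQ a α0 (ν.succAbove j)) x (EuclideanSpace.single μ (1 : ℝ))) =
      2 ^ n * (-1 : ℝ) ^ (n * (n - 1) / 2 + 1) /
          Real.sqrt ((-1 : ℝ) ^ (n + 1) * 2 ^ n *
            B0 (radius a α0) (cdist a) (Finset.univ : Finset (Fin (n + 1)))) *
        (- (∑ ν : Fin (n + 1),
              Bmix (radius a α0) (cdist a) ν (Finset.univ.erase ν) * fQ a α0 ν x)
          + B0s (radius a α0) (cdist a) (Finset.univ : Finset (Fin (n + 1)))) := by
  set b : Fin (n + 1) → Fin n → ℝ := fun j => (a j : Fin n → ℝ) + (x : Fin n → ℝ) with hb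
  have hdot (j k : Fin (n + 1)) : b j ⬝ᵥ b k = inner ℝ (a j + x) (a k + x) := by
    simp [hb, dotProduct, PiLp.inner_apply, mul_comm]
  have hρ (j k : Fin (n + 1)) :
      cdist a j k ^ 2 = b j ⬝ᵥ b j + b k ⬝ᵥ b k - 2 * b j ⬝ᵥ b k := by
    rw [cdist, dist_eq_norm, ← add_sub_add_right_eq_sub (a j) (a k) x, norm_sub_sq_real, hdot,
      hdot, hdot, real_inner_self_eq_norm_sq, real_inner_self_eq_norm_sq]
    ring
  have hf (j : Fin (n + 1)) : radius a α0 j ^ 2 + fQ a α0 j x = b j ⬝ᵥ b j := by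
    rw [radius, Real.sq_sqrt (hrad j).le, fQ, hdot, real_inner_self_eq_norm_sq, norm_add_sq_real]
    ring
  have hbracket := neg_sum_Bmix_add_B0s (radius a α0) (cdist a) fun j => fQ a α0 j x
  simp only [hf] at hbracket
  rw [sum_fQ_mul_jacobian, hbracket, det_fullMatrix_updateCol _ _ b _ hρ hf, B0_univ,
    Bdet_zero_idx _ _ b hρ, ← Finset.sum_range_id, pow_succ]
  have hpos := det_augMatrix_triangular_pos a htri hdiag
  rw [← det_augMatrix_add_const _ (x : Fin n → ℝ), Finset.sum_range_succ, pow_add] at hpos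
  change 0 < _ * Matrix.det (augMatrix 1 b) at hpos
  change 2 ^ n * Matrix.det (augMatrix (fun j => fQ a α0 j x) b) = _
  generalize Matrix.det (augMatrix (fun j => fQ a α0 j x) b) = F
  generalize Matrix.det (augMatrix 1 b) = D at *
  have hs : ((-1 : ℝ) ^ ∑ i ∈ Finset.range n, i) ^ 2 = 1 := by rw [← pow_mul, mul_comm]; simp
  have ht : ((-1 : ℝ) ^ n) ^ 2 = 1 := by rw [← pow_mul, mul_comm]; simp
  rw [show (-2 : ℝ) ^ n = (-1) ^ n * 2 ^ n by rw [← mul_pow]; norm_num, pow_succ (-1 : ℝ) n]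
  generalize (-1 : ℝ) ^ ∑ i ∈ Finset.range n, i = s at *
  generalize (-1 : ℝ) ^ n = t at *
  have htwo : (0 : ℝ) < 2 ^ n := by positivity
  generalize (2 : ℝ) ^ n = p at *
  have hsqrt : Real.sqrt (t * -1 * p * -(t * p * D ^ 2)) = p * (s * t * D) := by
    rw [← Real.sqrt_sq (mul_pos htwo hpos).le]
    congr 1
    linear_combination (-(p ^ 2 * t ^ 2 * D ^ 2)) * hs
  rw [hsqrt, div_mul_eq_mul_div, eq_div_iff (mul_pos htwo hpos).ne']
  ring

end SchlafliVol
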